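/- arXiv:1908.07591 — 4 statements merged into one kernel-verified Lean document; each statement's English description precedes it below -/
import Mathlib

section
/- Let P_J be uniformly distributed on [0, P_max] with P_max > 0, let a > 0, c > 0, σ² > 0, and define P_FA(τ) = Pr(c·P_J + σ² > τ), P_MD(τ) = Pr(a + c·P_J + σ² < τ), λ₁ = P_max·c + σ², λ₂ = a + σ², and P_e(τ) = P_FA(τ) + P_MD(τ). Then: (i) if λ₁ < λ₂, the infimum of P_e over all τ ∈ ℝ equals 0 and is attained at every τ ∈ [λ₁, λ₂]; (ii) if λ₁ ≥ λ₂, the infimum of P_e over all τ ∈ ℝ equals 1 − a/(P_max·c) and is attained at every τ ∈ [λ₂, λ₁]. -/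
open MeasureTheory Set

theorem aux_FA (P t : ℝ) (hP : 0 < P) :
    (((ENNReal.ofReal P)⁻¹ • (volume.restrict (Icc 0 P))) (Ioi t)).toReal
      = max (P - max t 0) 0 / P := by
  have h : (volume.restrict (Icc 0 P)) (Ioi t) = ENNReal.ofReal (P - max t 0) := by
    rw [← Measure.restrict_congr_set (Ioc_ae_eq_Icc (μ := volume) (a := (0:ℝ)) (b := P)),
      Measure.restrict_apply measurableSet_Ioi]
    have : Ioi t ∩ Ioc 0 P = Ioc (max t 0) P := by
      ext x; simp only [mem_inter_iff, mem_Ioi, mem_Ioc, max_lt_iff]; tauto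
    rw [this, Real.volume_Ioc]
  rw [Measure.smul_apply, h, smul_eq_mul, ENNReal.toReal_mul, ENNReal.toReal_inv,
    ENNReal.toReal_ofReal hP.le, ENNReal.toReal_ofReal', inv_mul_eq_div]

theorem aux_MD (P t : ℝ) (hP : 0 < P) :
    (((ENNReal.ofReal P)⁻¹ • (volume.restrict (Icc 0 P))) (Iio t)).toReal
      = max (min t P) 0 / P := by
  have h : (volume.restrict (Icc 0 P)) (Iio t) = ENNReal.ofReal (min t P) := by
    rw [← Measure.restrict_congr_set (Ico_ae_eq_Icc (μ := volume) (a := (0:ℝ)) (b := P)),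
      Measure.restrict_apply measurableSet_Iio]
    have : Iio t ∩ Ico 0 P = Ico 0 (min t P) := by
      ext x; simp only [mem_inter_iff, mem_Iio, mem_Ico, lt_min_iff]; tauto
    rw [this, Real.volume_Ico, sub_zero]
  rw [Measure.smul_apply, h, smul_eq_mul, ENNReal.toReal_mul, ENNReal.toReal_inv,
    ENNReal.toReal_ofReal hP.le, ENNReal.toReal_ofReal', inv_mul_eq_div]

theorem aux_sInf (f : ℝ → ℝ) (m x : ℝ) (hx : f x = m) (h : ∀ y, m ≤ f y) :
    sInf (Set.range f) = m := by
  apply IsLeast.csInf_eq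
  refine ⟨⟨x, hx⟩, ?_⟩
  rintro _ ⟨y, rfl⟩
  exact h y

/-- **Theorem 1 of the paper.** With `P_J` uniform on `[0, Pmax]`,
`P_FA τ = Pr (c·P_J + σ² > τ)`, `P_MD τ = Pr (a + c·P_J + σ² < τ)`,
`λ₁ = Pmax·c + σ²`, `λ₂ = a + σ²`, and `P_e τ = P_FA τ + P_MD τ`:
(i) if `λ₁ < λ₂` the infimum of `P_e` over all `τ ∈ ℝ` equals `0` and is attained at
every `τ ∈ [λ₁, λ₂]`; (ii) if `λ₁ ≥ λ₂` the infimum equals `1 - a/(Pmax·c)` and is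
attained at every `τ ∈ [λ₂, λ₁]`. -/
theorem optimal_detector_error
    (Pmax a c σ2 : ℝ) (hPmax : 0 < Pmax) (ha : 0 < a) (hc : 0 < c) (hσ : 0 < σ2)
    (μ : Measure ℝ) (hμ : μ = (ENNReal.ofReal Pmax)⁻¹ • (volume.restrict (Icc 0 Pmax)))
    (P_FA P_MD P_e : ℝ → ℝ)
    (hPFA : ∀ τ, P_FA τ = (μ {x | c * x + σ2 > τ}).toReal)
    (hPMD : ∀ τ, P_MD τ = (μ {x | a + c * x + σ2 < τ}).toReal)
    (hPe : ∀ τ, P_e τ = P_FA τ + P_MD τ)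
    (lam1 lam2 : ℝ) (hlam1 : lam1 = Pmax * c + σ2) (hlam2 : lam2 = a + σ2) :
    (lam1 < lam2 →
      sInf (Set.range P_e) = 0 ∧ ∀ τ ∈ Icc lam1 lam2, P_e τ = 0) ∧
    (lam1 ≥ lam2 →
      sInf (Set.range P_e) = 1 - a / (Pmax * c) ∧
        ∀ τ ∈ Icc lam2 lam1, P_e τ = 1 - a / (Pmax * c)) := by
  obtain ⟨b, rfl⟩ : ∃ b, a = c * b := ⟨a / c, by field_simp⟩
  have hb : 0 < b := by
    by_contra hb
    nlinarith
  have key : ∀ t, P_e (c * t + σ2)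
      = (max (Pmax - max t 0) 0 + max (min (t - b) Pmax) 0) / Pmax := by
    intro t
    have e1 : {x : ℝ | c * x + σ2 > c * t + σ2} = Ioi t := by
      ext x
      simp [hc]
    have e2 : {x : ℝ | c * b + c * x + σ2 < c * t + σ2} = Iio (t - b) := by
      ext x
      simp only [mem_setOf_eq, mem_Iio]
      rw [← mul_lt_mul_iff_right₀ hc (b := x)]
      constructor <;> intro h <;> linarith
    rw [hPe, hPFA, hPMD, e1, e2, hμ, aux_FA _ _ hPmax, aux_MD _ _ hPmax, add_div]
  have hex : ∀ τ, ∃ t, τ = c * t + σ2 := fun τ => ⟨(τ - σ2) / c, by field_simp; ring⟩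
  have hr : 1 - c * b / (Pmax * c) = (Pmax - b) / Pmax := by field_simp
  rw [hr]
  subst hlam1 hlam2
  refine ⟨fun hl => ?_, fun hl => ?_⟩
  · have hl' : Pmax < b := by
      by_contra h
      nlinarith
    have hatt : ∀ τ ∈ Icc (Pmax * c + σ2) (c * b + σ2), P_e τ = 0 := by
      rintro τ ⟨h1, h2⟩
      obtain ⟨t, rfl⟩ := hex τ
      have h1' : Pmax ≤ t := le_of_mul_le_mul_left (by linarith) hc
      have h2' : t ≤ b := le_of_mul_le_mul_left (by linarith) hc
      rw [key, max_eq_left (by linarith : (0:ℝ) ≤ t), max_eq_right (by linarith),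
        max_eq_right ((min_le_left _ _).trans (by linarith))]
      simp
    refine ⟨aux_sInf _ _ _ (hatt _ ⟨le_rfl, hl.le⟩) fun τ => ?_, hatt⟩
    rw [hPe, hPFA, hPMD]
    positivity
  · have hl' : b ≤ Pmax := le_of_mul_le_mul_left (by linarith) hc
    have hatt : ∀ τ ∈ Icc (c * b + σ2) (Pmax * c + σ2), P_e τ = (Pmax - b) / Pmax := by
      rintro τ ⟨h1, h2⟩
      obtain ⟨t, rfl⟩ := hex τ
      have h1' : b ≤ t := le_of_mul_le_mul_left (by linarith) hc
      have h2' : t ≤ Pmax := le_of_mul_le_mul_left (by linarith) hc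
      rw [key, max_eq_left (by linarith : (0:ℝ) ≤ t), max_eq_left (by linarith),
        min_eq_left (by linarith), max_eq_left (by linarith)]
      congr 1
      ring
    refine ⟨aux_sInf _ _ _ (hatt _ ⟨le_rfl, hl⟩) fun τ => ?_, hatt⟩
    obtain ⟨t, rfl⟩ := hex τ
    rw [key]
    apply div_le_div_of_nonneg_right _ hPmax.le
    rcases max_cases t 0 with h | h <;> rcases min_cases (t - b) Pmax with h' | h' <;>
    rcases max_cases (Pmax - max t 0) 0 with h'' | h'' <;>
    rcases max_cases (min (t - b) Pmax) 0 with h3 | h3 <;> linarith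
end

section
/- Let X and Y be independent random variables, each exponentially distributed with rate 1, and let c > 0. Then E[(X/Y)·1{X ≤ c·Y}] = ln(1 + c) − c/(1 + c). -/
open MeasureTheory ProbabilityTheory Set

lemma aux_expMeasure : expMeasure 1 =
    (volume.restrict (Ioi (0:ℝ))).withDensity (fun x => ENNReal.ofReal (Real.exp (-x))) := by
  have h1 : expMeasure 1 = volume.withDensity
      ((Ici (0:ℝ)).indicator (fun x => ENNReal.ofReal (Real.exp (-x)))) := by
    have : expMeasure 1 = volume.withDensity (exponentialPDF 1) := rfl
    rw [this]
    congr 1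
    ext x
    rw [exponentialPDF_eq]
    by_cases h : 0 ≤ x <;> simp [h, indicator]
  rw [h1, withDensity_indicator measurableSet_Ici, restrict_Ioi_eq_restrict_Ici]

lemma aux_integral (f : ℝ → ℝ) :
    ∫ x, f x ∂(expMeasure 1) = ∫ x in Ioi (0:ℝ), Real.exp (-x) * f x := by
  rw [aux_expMeasure, integral_withDensity_eq_integral_toReal_smul (by fun_prop) (by simp)]
  simp [ENNReal.toReal_ofReal, Real.exp_nonneg]

lemma aux_pos : ∀ᵐ x ∂(expMeasure 1), 0 < x := by
  rw [aux_expMeasure]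
  exact (withDensity_absolutelyContinuous _ _).ae_le (ae_restrict_mem measurableSet_Ioi)

lemma aux_inner (c y : ℝ) (hy : 0 < y) :
    ∫ x in Ioi (0:ℝ), Real.exp (-x) *
      ((x / y) * Set.indicator {p : ℝ × ℝ | p.1 ≤ c * p.2} (fun _ => (1 : ℝ)) (x, y)) =
    ∫ t in Ioc (0:ℝ) c, t * y * Real.exp (-(t * y)) := by
  have h := integral_comp_mul_right_Ioi (fun x => Real.exp (-x) *
      ((x / y) * Set.indicator {p : ℝ × ℝ | p.1 ≤ c * p.2} (fun _ => (1 : ℝ)) (x, y))) 0 hy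
  rw [zero_mul, smul_eq_mul, eq_inv_mul_iff_mul_eq₀ hy.ne'] at h
  rw [← h, ← integral_const_mul]
  have hs : Ioc (0:ℝ) c = Iic c ∩ Ioi 0 := by ext; simp [and_comm]
  rw [hs, ← Measure.restrict_restrict measurableSet_Iic, ← integral_indicator measurableSet_Iic]
  congr 1
  ext t
  by_cases ht : t ≤ c
  · simp [indicator, ht, hy]; field_simp
  · simp [indicator, ht, hy]

lemma aux_gamma (r : ℝ) (hr : 0 < r) :
    ∫ y in Ioi (0:ℝ), y * Real.exp (-(r * y)) = 1 / r ^ 2 := by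
  have h := Real.integral_rpow_mul_exp_neg_mul_Ioi (a := 2) two_pos hr
  have h2 : (2:ℝ) - 1 = 1 := by norm_num
  simpa [h2, Real.Gamma_two] using h

lemma aux_integrable (c : ℝ) :
    Integrable (Function.uncurry fun y t : ℝ => t * (y * Real.exp (-((1 + t) * y))))
      ((volume.restrict (Ioi (0:ℝ))).prod (volume.restrict (Ioc (0:ℝ) c))) := by
  have h0 : IntegrableOn (fun y : ℝ => y * Real.exp (-y)) (Ioi 0) := by
    have := aux_gamma 1 one_pos
    simp only [one_mul] at this
    exact .of_integral_ne_zero (by rw [this]; norm_num)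
  have h1 : Integrable (fun _ : ℝ => c) (volume.restrict (Ioc (0:ℝ) c)) := integrable_const _
  refine (h0.mul_prod h1).mono' ?_ ?_
  · apply Continuous.aestronglyMeasurable
    unfold Function.uncurry
    fun_prop
  · rw [Measure.prod_restrict]
    filter_upwards [ae_restrict_mem (measurableSet_Ioi.prod measurableSet_Ioc)]
    rintro ⟨y, t⟩ ⟨hy, ht⟩
    simp only [mem_Ioi, mem_Ioc] at hy ht
    obtain ⟨ht0, htc⟩ := ht
    simp only [Function.uncurry]
    rw [Real.norm_of_nonneg (by positivity), mul_comm]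
    gcongr
    nlinarith

lemma aux_final (c : ℝ) (hc : 0 < c) :
    ∫ t in Ioc (0:ℝ) c, t * (1 / (1 + t) ^ 2) = Real.log (1 + c) - c / (1 + c) := by
  rw [← intervalIntegral.integral_of_le hc.le,
    intervalIntegral.integral_eq_sub_of_hasDerivAt
      (f := fun t => Real.log (1 + t) - t / (1 + t))]
  · simp
  · intro t ht
    rw [uIcc_of_le hc.le] at ht
    have h : 1 + t ≠ 0 := by linarith [ht.1]
    have h1 : HasDerivAt (fun t : ℝ => 1 + t) 1 t := (hasDerivAt_id t).const_add 1
    convert (h1.log h).sub ((hasDerivAt_id t).div h1 h) using 1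
    · rfl
    · simp only [id]
      field_simp
      ring
  · apply ContinuousOn.intervalIntegrable
    rw [uIcc_of_le hc.le]
    refine continuousOn_id.mul (continuousOn_const.div (by fun_prop) ?_)
    intro t ht
    have : 0 < 1 + t := by linarith [ht.1]
    positivity

/-- Let `X` and `Y` be independent random variables, each exponentially
distributed with rate `1`, and let `c > 0`.  Then
`E[(X/Y)·1_{X ≤ c·Y}] = ln(1 + c) - c/(1 + c)`. -/
theorem exp_ratio_truncated_expectation
    {Ω : Type*} [MeasurableSpace Ω] (P : Measure Ω) [IsProbabilityMeasure P]
    (X Y : Ω → ℝ) (hX : Measurable X) (hY : Measurable Y)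
    (hXY : IndepFun X Y P)
    (hXlaw : P.map X = expMeasure 1) (hYlaw : P.map Y = expMeasure 1)
    (c : ℝ) (hc : 0 < c) :
    ∫ ω, (X ω / Y ω) * Set.indicator {ω | X ω ≤ c * Y ω} (fun _ => (1 : ℝ)) ω ∂P =
      Real.log (1 + c) - c / (1 + c) := by
  haveI : IsProbabilityMeasure (expMeasure 1) := isProbabilityMeasure_expMeasure one_pos
  set f : ℝ × ℝ → ℝ := fun p =>
    (p.1 / p.2) * Set.indicator {p : ℝ × ℝ | p.1 ≤ c * p.2} (fun _ => (1 : ℝ)) p with hf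
  have hfm : Measurable f := by
    refine (measurable_fst.div measurable_snd).mul (measurable_const.indicator ?_)
    exact measurableSet_le measurable_fst (measurable_snd.const_mul c)
  have hmap := (indepFun_iff_map_prod_eq_prod_map_map hX.aemeasurable hY.aemeasurable).1 hXY
  rw [hXlaw, hYlaw] at hmap
  have hXpos : ∀ᵐ ω ∂P, 0 < X ω := ae_of_ae_map hX.aemeasurable (hXlaw ▸ aux_pos)
  have hYpos : ∀ᵐ ω ∂P, 0 < Y ω := ae_of_ae_map hY.aemeasurable (hYlaw ▸ aux_pos)
  have hint : Integrable f ((expMeasure 1).prod (expMeasure 1)) := by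
    rw [← hmap, integrable_map_measure hfm.aestronglyMeasurable (hX.prodMk hY).aemeasurable]
    refine Integrable.of_bound (hfm.comp (hX.prodMk hY)).aestronglyMeasurable c ?_
    filter_upwards [hXpos, hYpos] with ω hx hy
    simp only [hf, Function.comp, indicator, mem_setOf_eq]
    split_ifs with h
    · rw [mul_one, Real.norm_of_nonneg (by positivity), div_le_iff₀ hy]
      exact h
    · simpa using hc.le
  have h1 : ∫ ω, (X ω / Y ω) * Set.indicator {ω | X ω ≤ c * Y ω} (fun _ => (1 : ℝ)) ω ∂P =
      ∫ p, f p ∂((expMeasure 1).prod (expMeasure 1)) := by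
    rw [← hmap, integral_map (hX.prodMk hY).aemeasurable hfm.aestronglyMeasurable]
    rfl
  rw [h1, integral_prod_symm f hint, aux_integral]
  simp_rw [aux_integral]
  have h2 : ∫ y in Ioi (0:ℝ), Real.exp (-y) * ∫ x in Ioi (0:ℝ), Real.exp (-x) * f (x, y) =
      ∫ y in Ioi (0:ℝ), ∫ t in Ioc (0:ℝ) c, t * (y * Real.exp (-((1 + t) * y))) := by
    refine setIntegral_congr_fun measurableSet_Ioi fun y hy => ?_
    simp only [hf]
    rw [aux_inner c y hy, ← integral_const_mul]
    congr 1
    ext t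
    have : -((1 + t) * y) = -y + -(t * y) := by ring
    rw [this, Real.exp_add]
    ring
  rw [h2, integral_integral_swap (aux_integrable c), ← aux_final c hc]
  refine setIntegral_congr_fun measurableSet_Ioc fun t ht => ?_
  rw [integral_const_mul, aux_gamma (1 + t) (by linarith [ht.1])]
end

section
/- Let ν ≥ 1 be an integer, η = ν·(ν!)^{−1/ν}, and let X, Y, P_J be independent random variables where X has CDF (1 − exp(−η·x))^ν on x ≥ 0, Y has the Gamma distribution with shape ν and rate ν, and P_J is uniform on [0, P_max] with P_max > 0. Then for any constants C₂ > 0 and C₃ ≥ 0: Pr(X < C₂·P_J·Y + C₃) = 1 + Σ_{l=1}^{ν} binom(ν, l)·(−1)^l·exp(−l·η·C₃)·(1/P_max)·∫_0^{P_max} (1 + l·η·C₂·x/ν)^{−ν} dx; moreover (1/P_max)·∫_0^{P_max} (1 + b·x)^{−1} dx = ln(1 + b·P_max)/(b·P_max) and, for ν ≥ 2, (1/P_max)·∫_0^{P_max} (1 + b·x)^{−ν} dx = (1 − (1 + b·P_max)^{1−ν})/(b·P_max·(ν − 1)) for any b > 0. -/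
open MeasureTheory ProbabilityTheory Real Finset Set

lemma aux_Iio (μ : Measure ℝ) [IsProbabilityMeasure μ] (F : ℝ → ℝ) (hF : Continuous F)
    (h : ∀ x, (μ (Set.Iic x)).toReal = F x) (x : ℝ) : (μ (Set.Iio x)).toReal = F x := by
  have hc : (cdf μ : ℝ → ℝ) = F := by
    funext y
    rw [cdf_eq_real, measureReal_def, h]
  have h1 : μ (Set.Iio x) = ENNReal.ofReal (F x) := by
    conv_lhs => rw [← measure_cdf μ]
    rw [StieltjesFunction.measure_Iio _ (tendsto_cdf_atBot μ), hc,
      leftLim_eq_of_tendsto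
        (hF.continuousAt.tendsto.mono_left nhdsWithin_le_nhds), sub_zero]
  rw [h1, ENNReal.toReal_ofReal]
  rw [← h]
  exact ENNReal.toReal_nonneg

lemma aux_gamma_s11 (ν : ℕ) (hν : 1 ≤ ν) (t : ℝ) (ht : 0 ≤ t) :
    ∫ y, Real.exp (-(t * y)) ∂(gammaMeasure (ν : ℝ) (ν : ℝ)) = (1 + t / ν) ^ (-(ν : ℤ)) := by
  have hn : (0 : ℝ) < ν := by exact_mod_cast hν
  have hm : Measurable (gammaPDF (ν : ℝ) (ν : ℝ)) :=
    (measurable_gammaPDFReal _ _).ennreal_ofReal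
  rw [gammaMeasure, integral_withDensity_eq_integral_toReal_smul hm
    (ae_of_all _ fun x => ENNReal.ofReal_lt_top)]
  have h1 : (fun y => (gammaPDF (ν : ℝ) (ν : ℝ) y).toReal • Real.exp (-(t * y))) =
      (Set.Ici (0 : ℝ)).indicator (fun y => ((ν : ℝ) ^ (ν : ℝ) / Real.Gamma ν) *
        (y ^ ((ν : ℝ) - 1) * Real.exp (-((ν + t) * y)))) := by
    funext y
    rw [gammaPDF, ENNReal.toReal_ofReal (gammaPDFReal_nonneg hn hn y), gammaPDFReal]
    by_cases hy : 0 ≤ y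
    · rw [if_pos hy, Set.indicator_of_mem (Set.mem_Ici.2 hy), smul_eq_mul,
        show -((ν + t) * y) = -(ν * y) + -(t * y) by ring, Real.exp_add]
      ring
    · rw [if_neg hy, Set.indicator_of_notMem (by simpa using hy), zero_smul]
  rw [h1, integral_indicator measurableSet_Ici, integral_Ici_eq_integral_Ioi, integral_const_mul,
    integral_rpow_mul_exp_neg_mul_Ioi hn (by positivity)]
  have hG := (Real.Gamma_pos_of_pos hn).ne'
  rw [Real.rpow_natCast, Real.rpow_natCast, zpow_neg, zpow_natCast]
  have h2 : (1 + t / ν : ℝ) = (ν + t) / ν := by field_simp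
  have h3 : (ν + t : ℝ) ≠ 0 := by positivity
  rw [h2, div_pow, div_pow]
  field_simp
  simp

lemma aux_gamma_ae (ν : ℕ) : ∀ᵐ y ∂(gammaMeasure (ν : ℝ) (ν : ℝ)), 0 ≤ y := by
  have hm : Measurable (gammaPDF (ν : ℝ) (ν : ℝ)) :=
    (measurable_gammaPDFReal _ _).ennreal_ofReal
  rw [gammaMeasure, ae_withDensity_iff hm]
  refine ae_of_all _ fun x hx => ?_
  by_contra hneg
  exact hx (gammaPDF_of_neg (not_le.1 hneg))

lemma aux_prob (ν : ℕ) (hν : 1 ≤ ν) (η : ℝ) (hη : 0 ≤ η)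
    (Pmax : ℝ) (hPmax : 0 < Pmax)
    (μX : Measure ℝ) [IsProbabilityMeasure μX]
    (hX : ∀ x : ℝ, (μX (Set.Iic x)).toReal =
      if 0 ≤ x then (1 - Real.exp (-η * x)) ^ ν else 0)
    (μU : Measure ℝ)
    (hμU : μU = (ENNReal.ofReal Pmax)⁻¹ • (volume.restrict (Set.Icc 0 Pmax)))
    (C2 C3 : ℝ) (hC2 : 0 < C2) (hC3 : 0 ≤ C3) :
    ((μX.prod ((gammaMeasure (ν : ℝ) (ν : ℝ)).prod μU))
        {z : ℝ × ℝ × ℝ | z.1 < C2 * z.2.2 * z.2.1 + C3}).toReal =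
      1 + ∑ l ∈ Finset.Icc 1 ν, (ν.choose l : ℝ) * (-1) ^ l * Real.exp (-(l : ℝ) * η * C3) *
        ((1 / Pmax) * ∫ x in (0 : ℝ)..Pmax, (1 + l * η * C2 * x / ν) ^ (-(ν : ℤ))) := by
  have hn : (0 : ℝ) < ν := by exact_mod_cast hν
  have : IsProbabilityMeasure (gammaMeasure (ν : ℝ) (ν : ℝ)) :=
    isProbabilityMeasure_gammaMeasure hn hn
  have : IsProbabilityMeasure μU := by
    constructor
    rw [hμU]
    simp only [Measure.smul_apply, Measure.restrict_apply MeasurableSet.univ, Set.univ_inter,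
      Real.volume_Icc, sub_zero, smul_eq_mul]
    exact ENNReal.inv_mul_cancel (by simpa using hPmax) ENNReal.ofReal_ne_top
  have hUae : ∀ᵐ u ∂μU, u ∈ Set.Icc 0 Pmax := by
    rw [hμU]
    exact Measure.ae_smul_measure (ae_restrict_mem measurableSet_Icc) _
  have hUint : ∀ f : ℝ → ℝ, ∫ u, f u ∂μU = (1 / Pmax) * ∫ x in (0 : ℝ)..Pmax, f x := by
    intro f
    rw [hμU, integral_smul_measure, intervalIntegral.integral_of_le hPmax.le,
      integral_Icc_eq_integral_Ioc, ENNReal.toReal_inv, ENNReal.toReal_ofReal hPmax.le,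
      smul_eq_mul, one_div]
  have hIio : ∀ x, (μX (Set.Iio x)).toReal = (1 - Real.exp (-η * max x 0)) ^ ν := by
    refine aux_Iio μX _ (by fun_prop) fun x => ?_
    rw [hX]
    split_ifs with h
    · rw [max_eq_left h]
    · rw [max_eq_right (le_of_not_ge h)]
      simp [show ν ≠ 0 by omega]
  have hS : MeasurableSet {z : ℝ × ℝ × ℝ | z.1 < C2 * z.2.2 * z.2.1 + C3} :=
    measurableSet_lt (by fun_prop) (by fun_prop)
  have hae : ∀ᵐ p ∂((gammaMeasure (ν : ℝ) (ν : ℝ)).prod μU), 0 ≤ p.1 ∧ p.2 ∈ Set.Icc 0 Pmax :=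
    (Measure.quasiMeasurePreserving_fst.ae (aux_gamma_ae ν)).and
      (Measure.quasiMeasurePreserving_snd.ae hUae)
  have hint : ∀ l : ℕ, Integrable (fun p : ℝ × ℝ => Real.exp (-((l * η * C2 * p.2) * p.1)))
      ((gammaMeasure (ν : ℝ) (ν : ℝ)).prod μU) := by
    intro l
    refine Integrable.of_bound (C := 1) (by fun_prop) ?_
    filter_upwards [hae] with p hp
    rw [Real.norm_eq_abs, abs_of_pos (Real.exp_pos _), Real.exp_le_one_iff]
    have h1 := hp.1
    have h2 := hp.2.1
    have : 0 ≤ (l * η * C2 * p.2) * p.1 := by positivity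
    linarith
  rw [Measure.prod_apply_symm hS, ← integral_toReal
    (measurable_measure_prodMk_right hS).aemeasurable (ae_of_all _ fun p => measure_lt_top _ _)]
  have step : ∫ p : ℝ × ℝ, (μX ((fun x => (x, p)) ⁻¹'
        {z : ℝ × ℝ × ℝ | z.1 < C2 * z.2.2 * z.2.1 + C3})).toReal
        ∂((gammaMeasure (ν : ℝ) (ν : ℝ)).prod μU) =
      ∫ p : ℝ × ℝ, ∑ l ∈ Finset.range (ν + 1),
        ((ν.choose l : ℝ) * (-1) ^ l * Real.exp (-(l : ℝ) * η * C3)) *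
          Real.exp (-((l * η * C2 * p.2) * p.1))
        ∂((gammaMeasure (ν : ℝ) (ν : ℝ)).prod μU) := by
    refine integral_congr_ae ?_
    filter_upwards [hae] with p hp
    have h1 := hp.1
    have h2 := hp.2.1
    have h3 : 0 ≤ C2 * p.2 * p.1 + C3 := by positivity
    change (μX (Set.Iio (C2 * p.2 * p.1 + C3))).toReal = _
    rw [hIio, max_eq_left h3, sub_eq_neg_add, add_pow]
    refine Finset.sum_congr rfl fun l _ => ?_
    rw [one_pow, mul_one, neg_pow, ← Real.exp_nat_mul,
      show (l : ℝ) * (-η * (C2 * p.2 * p.1 + C3)) =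
        -(l : ℝ) * η * C3 + -((l * η * C2 * p.2) * p.1) by ring, Real.exp_add]
    ring
  rw [step, integral_finsetSum _ fun l _ => (hint l).const_mul _]
  have key : ∀ l : ℕ, ∫ p : ℝ × ℝ, ((ν.choose l : ℝ) * (-1) ^ l * Real.exp (-(l : ℝ) * η * C3)) *
          Real.exp (-((l * η * C2 * p.2) * p.1)) ∂((gammaMeasure (ν : ℝ) (ν : ℝ)).prod μU) =
      (ν.choose l : ℝ) * (-1) ^ l * Real.exp (-(l : ℝ) * η * C3) *
        ((1 / Pmax) * ∫ x in (0 : ℝ)..Pmax, (1 + l * η * C2 * x / ν) ^ (-(ν : ℤ))) := by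
    intro l
    rw [integral_const_mul, integral_prod_symm _ (hint l), ← hUint]
    congr 1
    refine integral_congr_ae ?_
    filter_upwards [hUae] with u hu
    have := hu.1
    exact aux_gamma_s11 ν hν _ (by positivity)
  rw [Finset.sum_congr rfl fun l _ => key l, Finset.range_eq_Ico,
    Finset.sum_eq_sum_Ico_succ_bot (by omega)]
  congr 1
  simp [hPmax.ne']

/-- **conditional outage computation in Theorem 3.** Let `ν ≥ 1` be an
integer, `η = ν·(ν!)^{−1/ν}`, and let `X`, `Y`, `P_J` be independent with `X` having the
Alzer CDF `(1 − exp(−η·x))^ν` on `x ≥ 0`, `Y ∼ Gamma(ν, ν)`, and `P_J` uniform on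
`[0, Pmax]`.  Then for constants `C₂ > 0`, `C₃ ≥ 0`,
`Pr(X < C₂·P_J·Y + C₃) = 1 + ∑_{l=1}^{ν} C(ν,l)·(−1)^l·exp(−l·η·C₃)·
(1/Pmax)·∫_0^{Pmax} (1 + l·η·C₂·x/ν)^{−ν} dx`; moreover for any `b > 0`,
`(1/Pmax)·∫_0^{Pmax} (1 + b·x)^{−1} dx = ln(1 + b·Pmax)/(b·Pmax)` and, for `ν ≥ 2`,
`(1/Pmax)·∫_0^{Pmax} (1 + b·x)^{−ν} dx = (1 − (1 + b·Pmax)^{1−ν})/(b·Pmax·(ν − 1))`. -/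
theorem conditional_outage_probability
    (ν : ℕ) (hν : 1 ≤ ν) (η : ℝ) (hη : η = ν * ((Nat.factorial ν : ℝ) ^ (-(ν : ℝ)⁻¹)))
    (Pmax : ℝ) (hPmax : 0 < Pmax)
    (μX : Measure ℝ) [IsProbabilityMeasure μX]
    (hX : ∀ x : ℝ, (μX (Iic x)).toReal =
      if 0 ≤ x then (1 - Real.exp (-η * x)) ^ ν else 0)
    (μU : Measure ℝ) (hμU : μU = (ENNReal.ofReal Pmax)⁻¹ • (volume.restrict (Icc 0 Pmax)))
    (C2 C3 : ℝ) (hC2 : 0 < C2) (hC3 : 0 ≤ C3) :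
    ((μX.prod ((gammaMeasure (ν : ℝ) (ν : ℝ)).prod μU))
        {z : ℝ × ℝ × ℝ | z.1 < C2 * z.2.2 * z.2.1 + C3}).toReal =
      1 + ∑ l ∈ Icc 1 ν, (ν.choose l : ℝ) * (-1) ^ l * Real.exp (-(l : ℝ) * η * C3) *
        ((1 / Pmax) * ∫ x in (0 : ℝ)..Pmax, (1 + l * η * C2 * x / ν) ^ (-(ν : ℤ)))
    ∧ (∀ b : ℝ, 0 < b →
        (1 / Pmax) * ∫ x in (0 : ℝ)..Pmax, (1 + b * x)⁻¹ =
          Real.log (1 + b * Pmax) / (b * Pmax))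
    ∧ (∀ b : ℝ, 0 < b → 2 ≤ ν →
        (1 / Pmax) * ∫ x in (0 : ℝ)..Pmax, (1 + b * x) ^ (-(ν : ℤ)) =
          (1 - (1 + b * Pmax) ^ (1 - (ν : ℤ))) / (b * Pmax * ((ν : ℝ) - 1))) := by
  have hη0 : 0 ≤ η := by rw [hη]; positivity
  refine ⟨aux_prob ν hν η hη0 Pmax hPmax μX hX μU hμU C2 C3 hC2 hC3, fun b hb => ?_,
    fun b hb h2 => ?_⟩
  · have hp : 0 < 1 + b * Pmax := by positivity
    rw [intervalIntegral.integral_comp_add_mul (fun x => x⁻¹) hb.ne' 1, mul_zero, add_zero,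
      integral_inv_of_pos one_pos hp, div_one, smul_eq_mul]
    field_simp
  · have hp : 0 < 1 + b * Pmax := by positivity
    have hν1 : (ν : ℝ) - 1 ≠ 0 := by
      have : (2 : ℝ) ≤ ν := by exact_mod_cast h2
      linarith
    have hν2 : -(ν : ℝ) + 1 ≠ 0 := fun h => hν1 (by linarith)
    rw [intervalIntegral.integral_comp_add_mul (fun x => x ^ (-(ν : ℤ))) hb.ne' 1, mul_zero,
      add_zero, integral_zpow (Or.inr ⟨by omega, Set.notMem_uIcc_of_lt one_pos hp⟩), one_zpow,
      smul_eq_mul, show -(ν : ℤ) + 1 = 1 - ν by ring]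
    push_cast
    rw [show -(ν : ℝ) + 1 = -((ν : ℝ) - 1) by ring]
    generalize (1 + b * Pmax) ^ (1 - (ν : ℤ)) = A
    field_simp
    ring
end

section
/- For each blockage state B ∈ {L, N}, fix an integer ν_B ≥ 1, set η_B = ν_B·(ν_B!)^{−1/ν_B}, and fix a path loss L_B > 0; fix probabilities P_L ∈ [0,1], P_N = 1 − P_L; fix transmitter gains g₁^{(a)}, g₂^{(a)} > 0 with probabilities b₁^{(a)}, b₂^{(a)} = 1 − b₁^{(a)}, receiver gains g₁^{(b)}, g₂^{(b)} > 0 with probabilities b₁^{(b)}, b₂^{(b)} = 1 − b₁^{(b)}; and fix positive reals P_a, P_max, m_s, γ_th, σ_b². Consider the random model: blockage B, transmitter gain g^{(a)}, receiver gain g^{(b)} drawn independently with the above probabilities, and, conditionally on B, independent X_B with CDF (1 − exp(−η_B·x))^{ν_B}, Y_B with Gamma distribution of shape ν_B and rate ν_B, and P_J uniform on [0, P_max]. Then the outage probability P_out = Pr( P_a·g^{(a)}·g^{(b)}·L_B·X_B < γ_th·(P_J·m_s·g^{(b)}·L_B·Y_B + σ_b²) ) equals Σ_{B∈{L,N}}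 P_B · Σ_{k₁=1}^{2} b_{k₁}^{(a)} · Σ_{k₂=1}^{2} b_{k₂}^{(b)} · [1 + Σ_{l=1}^{ν_B} binom(ν_B, l)·(−1)^l·exp(−l·η_B·γ_th·σ_b²/(P_a·g_{k₁}^{(a)}·g_{k₂}^{(b)}·L_B))·V(ν_B, l, g_{k₁}^{(a)})], where V(1, l, g) = (P_a·g/(P_max·l·γ_th·m_s))·ln(1 + P_max·l·γ_th·m_s/(P_a·g)) and, for ν ≥ 2, V(ν, l, g) = (ν·P_a·g/(P_max·l·η·γ_th·m_s·(ν − 1)))·[1 − (1 + P_max·l·η·γ_th·m_s/(ν·P_a·g))^{1−ν}] with η = ν·(ν!)^{−1/ν}. -/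
open MeasureTheory ProbabilityTheory Real Finset Set

/-- `η_ν = ν · (ν!)^(−1/ν)`, the Alzer constant. -/
noncomputable def etaNak (ν : ℕ) : ℝ := ν * ((Nat.factorial ν : ℝ) ^ (-(ν : ℝ)⁻¹))

/-- `V(1, l, g) = (Pa·g/(Pmax·l·γ·ms))·ln(1 + Pmax·l·γ·ms/(Pa·g))` and, for `ν ≥ 2`,
`V(ν, l, g) = (ν·Pa·g/(Pmax·l·η·γ·ms·(ν−1)))·[1 − (1 + Pmax·l·η·γ·ms/(ν·Pa·g))^{1−ν}]`. -/
noncomputable def Vfun (Pa Pmax ms γth : ℝ) (ν l : ℕ) (g : ℝ) : ℝ :=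
  if ν = 1 then
    Pa * g / (Pmax * l * γth * ms) * Real.log (1 + Pmax * l * γth * ms / (Pa * g))
  else
    ν * Pa * g / (Pmax * l * etaNak ν * γth * ms * ((ν : ℝ) - 1)) *
      (1 - (1 + Pmax * l * etaNak ν * γth * ms / (ν * Pa * g)) ^ (1 - (ν : ℤ)))

/-- The conditional outage probability of the Alice–Bob link given the blockage state
(Nakagami parameter `ν`, fading laws `μX` for the desired path and `Gamma(ν,ν)` for the
jamming path, path loss `L`) and the antenna gains `ga`, `gb`; the jamming power is
uniform on `[0, Pmax]`, independent of the fading. -/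
noncomputable def condOutage (Pa Pmax ms γth σb2 L : ℝ) (μX : Measure ℝ) (ν : ℕ)
    (ga gb : ℝ) : ℝ :=
  ((μX.prod ((gammaMeasure (ν : ℝ) (ν : ℝ)).prod
      ((ENNReal.ofReal Pmax)⁻¹ • (volume.restrict (Icc 0 Pmax)))))
    {z : ℝ × ℝ × ℝ | Pa * ga * gb * L * z.1 <
      γth * (z.2.2 * ms * gb * L * z.2.1 + σb2)}).toReal

/-- The closed-form conditional outage
`1 + ∑_{l=1}^{ν} C(ν,l)·(−1)^l·exp(−l·η·γ·σb²/(Pa·ga·gb·L))·V(ν, l, ga)`. -/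
noncomputable def bracketOut (Pa Pmax ms γth σb2 L : ℝ) (ν : ℕ) (ga gb : ℝ) : ℝ :=
  1 + ∑ l ∈ Icc 1 ν, (ν.choose l : ℝ) * (-1) ^ l *
    Real.exp (-(l : ℝ) * etaNak ν * γth * σb2 / (Pa * ga * gb * L)) *
    Vfun Pa Pmax ms γth ν l ga

lemma etaNak_pos {ν : ℕ} (h : 1 ≤ ν) : 0 < etaNak ν := by
  have : (0 : ℝ) < ν := by exact_mod_cast h
  unfold etaNak
  have := Nat.factorial_pos ν
  positivity

lemma etaNak_one : etaNak 1 = 1 := by simp [etaNak]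

lemma alzer_Iio (μ : Measure ℝ) [IsProbabilityMeasure μ] (ν : ℕ) (η : ℝ)
    (hX : ∀ x : ℝ, (μ (Iic x)).toReal =
      if 0 ≤ x then (1 - Real.exp (-η * x)) ^ ν else 0) {t : ℝ} (ht : 0 < t) :
    (μ (Iio t)).toReal = (1 - Real.exp (-η * t)) ^ ν := by
  apply le_antisymm
  · have := hX t
    rw [if_pos ht.le] at this
    rw [← this]
    exact ENNReal.toReal_mono (measure_ne_top _ _) (measure_mono Iio_subset_Iic_self)
  · have hc : Continuous fun x : ℝ => (1 - Real.exp (-η * x)) ^ ν := by fun_prop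
    have h1 : Filter.Tendsto (fun x : ℝ => (1 - Real.exp (-η * x)) ^ ν) (nhdsWithin t (Iio t))
        (nhds ((1 - Real.exp (-η * t)) ^ ν)) := (hc.tendsto t).mono_left nhdsWithin_le_nhds
    refine le_of_tendsto h1 ?_
    have h2 : ∀ᶠ x in nhdsWithin t (Iio t), 0 < x :=
      nhdsWithin_le_nhds (lt_mem_nhds ht)
    filter_upwards [h2, self_mem_nhdsWithin] with x hx hxt
    have := hX x
    rw [if_pos hx.le] at this
    rw [← this]
    exact ENNReal.toReal_mono (measure_ne_top _ _)
      (measure_mono (fun y hy => Set.mem_Iio.2 (lt_of_le_of_lt (Set.mem_Iic.1 hy) (Set.mem_Iio.1 hxt))))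

lemma gamma_ae_nonneg (a r : ℝ) : ∀ᵐ y ∂(gammaMeasure a r), 0 ≤ y := by
  rw [ae_iff]
  have : {y : ℝ | ¬ 0 ≤ y} = Set.Iio 0 := by ext; simp
  rw [this, gammaMeasure, withDensity_apply _ measurableSet_Iio]
  exact lintegral_gammaPDF_of_nonpos le_rfl

lemma gamma_laplace {ν : ℕ} (h : 1 ≤ ν) {s : ℝ} (hs : 0 ≤ s) :
    ∫ y, Real.exp (-(s * y)) ∂(gammaMeasure (ν : ℝ) (ν : ℝ)) = ((1 + s / ν) ^ ν)⁻¹ := by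
  have hν : (0 : ℝ) < ν := by exact_mod_cast h
  rw [gammaMeasure, integral_withDensity_eq_integral_toReal_smul]
  rotate_left
  · exact (measurable_gammaPDFReal _ _).ennreal_ofReal
  · exact ae_of_all _ fun x => ENNReal.ofReal_lt_top
  have e1 : (fun x : ℝ => (gammaPDF (ν : ℝ) ν x).toReal • Real.exp (-(s * x))) =
      (Ici (0 : ℝ)).indicator (fun x => ((ν : ℝ) ^ (ν : ℝ) / Real.Gamma ν) *
        (x ^ ((ν : ℝ) - 1) * Real.exp (-((ν + s) * x)))) := by
    ext x
    rw [gammaPDF, ENNReal.toReal_ofReal (gammaPDFReal_nonneg hν hν x), smul_eq_mul, gammaPDFReal]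
    by_cases hx : 0 ≤ x
    · rw [if_pos hx, indicator_of_mem (by exact hx)]
      have : Real.exp (-((ν + s) * x)) = Real.exp (-(ν * x)) * Real.exp (-(s * x)) := by
        rw [← Real.exp_add]; congr 1; ring
      rw [this]; ring
    · rw [if_neg hx, indicator_of_notMem (by exact hx), zero_mul]
  rw [e1, integral_indicator measurableSet_Ici, integral_Ici_eq_integral_Ioi,
    integral_const_mul, Real.integral_rpow_mul_exp_neg_mul_Ioi hν (by positivity)]
  have hG := (Real.Gamma_pos_of_pos hν).ne'
  rw [Real.rpow_natCast, Real.rpow_natCast]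
  have : (1 + s / ν) = (ν + s) / ν := by field_simp
  rw [this, div_pow, div_pow, one_pow]
  field_simp

lemma unif_avg {ν : ℕ} (h : 1 ≤ ν) {c P : ℝ} (hc : 0 < c) (hP : 0 < P) :
    ∫ p, ((1 + c * p) ^ ν)⁻¹ ∂((ENNReal.ofReal P)⁻¹ • (volume.restrict (Icc 0 P))) =
      if ν = 1 then (P * c)⁻¹ * Real.log (1 + P * c)
      else (P * c * ((ν : ℝ) - 1))⁻¹ * (1 - (1 + P * c) ^ (1 - (ν : ℤ))) := by
  rw [integral_smul_measure, ENNReal.toReal_inv, ENNReal.toReal_ofReal hP.le, smul_eq_mul,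
    integral_Icc_eq_integral_Ioc, ← intervalIntegral.integral_of_le hP.le]
  have hpos : ∀ p ∈ uIcc 0 P, 0 < 1 + c * p := by
    intro p hp
    rw [uIcc_of_le hP.le] at hp
    have := hp.1
    positivity
  have hint : IntervalIntegrable (fun p : ℝ => ((1 + c * p) ^ ν)⁻¹) volume 0 P := by
    apply ContinuousOn.intervalIntegrable
    apply ContinuousOn.inv₀ (by fun_prop)
    intro p hp
    have := hpos p hp
    positivity
  have hlin : ∀ p : ℝ, HasDerivAt (fun p : ℝ => 1 + c * p) c p := by
    intro p
    simpa using ((hasDerivAt_id p).const_mul c).const_add 1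
  split_ifs with h1
  · subst h1
    have hd : ∀ p ∈ uIcc 0 P, HasDerivAt (fun p : ℝ => c⁻¹ * Real.log (1 + c * p))
        (((1 + c * p) ^ 1)⁻¹) p := by
      intro p hp
      convert! ((hlin p).log (hpos p hp).ne').const_mul c⁻¹ using 1
      have := hpos p hp
      field_simp
    rw [intervalIntegral.integral_eq_sub_of_hasDerivAt hd hint]
    simp only [mul_zero, add_zero, Real.log_one, sub_zero]
    rw [mul_comm c P]
    field_simp
  · obtain ⟨n, rfl⟩ : ∃ n, ν = n + 2 := ⟨ν - 2, by omega⟩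
    have hd : ∀ p ∈ uIcc 0 P, HasDerivAt
        (fun p : ℝ => -(c * (n + 1))⁻¹ * ((1 + c * p) ^ (n + 1))⁻¹)
        (((1 + c * p) ^ (n + 2))⁻¹) p := by
      intro p hp
      have hp' := hpos p hp
      convert! ((((hlin p).fun_pow (n + 1)).fun_inv (by positivity)).const_mul
        (-(c * ((n : ℝ) + 1))⁻¹)) using 1
      simp only [Nat.add_sub_cancel]
      push_cast
      field_simp
      ring
    rw [intervalIntegral.integral_eq_sub_of_hasDerivAt hd hint]
    have hz : (1 + P * c) ^ (1 - ((n + 2 : ℕ) : ℤ)) = ((1 + c * P) ^ (n + 1))⁻¹ := by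
      rw [show (1 - ((n + 2 : ℕ) : ℤ)) = -((n + 1 : ℕ) : ℤ) by push_cast; ring, zpow_neg,
        zpow_natCast, mul_comm P c]
    rw [hz]
    have h3 : (((n + 2 : ℕ) : ℝ) - 1) = n + 1 := by push_cast; ring
    rw [h3]
    simp only [mul_zero, add_zero, one_pow, inv_one]
    have : (0 : ℝ) < n + 1 := by positivity
    rw [mul_inv, mul_inv, mul_inv]
    ring

lemma cond_eq (Pa Pmax ms γth σb2 L : ℝ)
    (hPa : 0 < Pa) (hPmax : 0 < Pmax) (hms : 0 < ms) (hγ : 0 < γth) (hσ : 0 < σb2)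
    (hL : 0 < L) (ν : ℕ) (hν : 1 ≤ ν) (μ : Measure ℝ) [IsProbabilityMeasure μ]
    (hX : ∀ x : ℝ, (μ (Iic x)).toReal =
      if 0 ≤ x then (1 - Real.exp (-(etaNak ν) * x)) ^ ν else 0)
    (ga gb : ℝ) (hga : 0 < ga) (hgb : 0 < gb) :
    condOutage Pa Pmax ms γth σb2 L μ ν ga gb = bracketOut Pa Pmax ms γth σb2 L ν ga gb := by
  have hν' : (0 : ℝ) < ν := by exact_mod_cast hν
  have hη := etaNak_pos hν
  haveI : IsProbabilityMeasure (gammaMeasure (ν : ℝ) (ν : ℝ)) :=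
    isProbabilityMeasure_gammaMeasure hν' hν'
  unfold condOutage
  set G := gammaMeasure (ν : ℝ) (ν : ℝ) with hG
  set U : Measure ℝ := (ENNReal.ofReal Pmax)⁻¹ • (volume.restrict (Icc 0 Pmax)) with hU
  haveI : IsProbabilityMeasure U := by
    constructor
    rw [hU]
    simp only [Measure.smul_apply, Measure.restrict_apply_univ, Real.volume_Icc, sub_zero,
      smul_eq_mul]
    exact ENNReal.inv_mul_cancel (by simpa using hPmax) ENNReal.ofReal_ne_top
  have hUae : ∀ᵐ p ∂U, 0 ≤ p := by
    rw [hU]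
    apply Measure.ae_smul_measure
    filter_upwards [ae_restrict_mem measurableSet_Icc] with p hp using hp.1
  have hae : ∀ᵐ w ∂(G.prod U), 0 ≤ w.1 ∧ 0 ≤ w.2 := by
    have h1 : ∀ᵐ w ∂(G.prod U), 0 ≤ w.1 :=
      Measure.quasiMeasurePreserving_fst.ae (gamma_ae_nonneg _ _)
    have h2 : ∀ᵐ w ∂(G.prod U), 0 ≤ w.2 := Measure.quasiMeasurePreserving_snd.ae hUae
    filter_upwards [h1, h2] with w a b using ⟨a, b⟩
  have hmeas : MeasurableSet {z : ℝ × ℝ × ℝ | Pa * ga * gb * L * z.1 <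
      γth * (z.2.2 * ms * gb * L * z.2.1 + σb2)} :=
    measurableSet_lt (by fun_prop) (by fun_prop)
  rw [Measure.prod_apply_symm hmeas, ← integral_toReal
    (measurable_measure_prodMk_right hmeas).aemeasurable (ae_of_all _ fun _ => measure_lt_top _ _)]
  set A : ℕ → ℝ := fun l => (ν.choose l : ℝ) * (-1) ^ l *
    Real.exp (-(l : ℝ) * etaNak ν * γth * σb2 / (Pa * ga * gb * L)) with hA
  set s : ℕ → ℝ := fun l => l * etaNak ν * γth * ms / (Pa * ga) with hs
  have hs0 : ∀ l, 0 ≤ s l := fun l => by simp only [hs]; positivity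
  have hcong : (fun w : ℝ × ℝ => (μ ((fun x => (x, w)) ⁻¹' {z : ℝ × ℝ × ℝ |
      Pa * ga * gb * L * z.1 < γth * (z.2.2 * ms * gb * L * z.2.1 + σb2)})).toReal)
      =ᵐ[G.prod U] fun w => ∑ l ∈ Finset.range (ν + 1), A l * Real.exp (-(s l * w.2 * w.1)) := by
    filter_upwards [hae] with w hw
    obtain ⟨h1, h2⟩ := hw
    have hK : 0 < Pa * ga * gb * L := by positivity
    set t := γth * (w.2 * ms * gb * L * w.1 + σb2) / (Pa * ga * gb * L) with ht
    have ht0 : 0 < t := by positivity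
    have hset : ((fun x => (x, w)) ⁻¹' {z : ℝ × ℝ × ℝ |
      Pa * ga * gb * L * z.1 < γth * (z.2.2 * ms * gb * L * z.2.1 + σb2)}) = Iio t := by
      ext x
      simp only [Set.mem_preimage, Set.mem_ofPred_eq, Set.mem_Iio, ht]
      rw [lt_div_iff₀ hK, mul_comm]
    rw [hset, alzer_Iio μ ν _ hX ht0, sub_eq_neg_add, add_pow]
    apply Finset.sum_congr rfl
    intro l _
    rw [one_pow, mul_one, neg_pow, ← Real.exp_nat_mul]
    have : Real.exp (l * (-etaNak ν * t)) =
        Real.exp (-(l : ℝ) * etaNak ν * γth * σb2 / (Pa * ga * gb * L)) *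
          Real.exp (-(s l * w.2 * w.1)) := by
      rw [← Real.exp_add]
      congr 1
      simp only [ht, hs]
      field_simp
      ring
    rw [this]
    simp only [hA]
    ring
  rw [integral_congr_ae hcong]
  have hI : ∀ l, Integrable (fun w : ℝ × ℝ => Real.exp (-(s l * w.2 * w.1))) (G.prod U) := by
    intro l
    refine Integrable.of_bound (by fun_prop) 1 ?_
    filter_upwards [hae] with w hw
    obtain ⟨h1, h2⟩ := hw
    rw [Real.norm_eq_abs, abs_of_pos (Real.exp_pos _), Real.exp_le_one_iff]
    have := hs0 l
    have : 0 ≤ s l * w.2 * w.1 := by positivity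
    linarith
  rw [integral_finset_sum _ (fun l _ => (hI l).const_mul _)]
  have hval : ∀ l, ∫ w, A l * Real.exp (-(s l * w.2 * w.1)) ∂(G.prod U) =
      A l * ∫ p, ((1 + s l / ν * p) ^ ν)⁻¹ ∂U := by
    intro l
    rw [integral_const_mul, integral_prod_symm _ (hI l)]
    congr 1
    apply integral_congr_ae
    filter_upwards [hUae] with p hp
    have := hs0 l
    have h3 := gamma_laplace hν (s := s l * p) (by positivity)
    simp only [hG]
    rw [h3]
    congr 3
    ring
  rw [Finset.sum_congr rfl (fun l _ => hval l), Finset.range_eq_Ico,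
    Finset.sum_eq_sum_Ico_succ_bot (by omega)]
  unfold bracketOut
  congr 1
  · simp [hA, hs]
  · apply Finset.sum_congr (by ext; simp <;> omega)
    intro l hl
    have hl1 : 1 ≤ l := by simp at hl; omega
    have hl' : (0 : ℝ) < l := by exact_mod_cast hl1
    simp only [hA]
    congr 1
    rw [hU, unif_avg hν (by simp only [hs]; positivity) hPmax, Vfun]
    split_ifs with h1
    · subst h1
      simp only [hs, etaNak_one]
      congr 1
      · field_simp
        try norm_num
      · congr 2
        field_simp
        try norm_num
    · have e : Pmax * (s l / ν) = Pmax * l * etaNak ν * γth * ms / (ν * Pa * ga) := by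
        simp only [hs]; field_simp
      rw [e]
      congr 1
      have : (ν : ℝ) - 1 ≠ 0 := by
        intro h
        apply h1
        have : (ν : ℝ) = 1 := by linarith
        exact_mod_cast this
      field_simp

/-- **Theorem 3 of the paper.** With the blockage state `B ∈ {L, N}`
(probabilities `P_L`, `1 − P_L`, path losses `L_B`, Nakagami parameters `ν_B`), the
transmitter gain `g^{(a)} ∈ {ga₁, ga₂}` (probabilities `ba₁`, `ba₂ = 1 − ba₁`), the
receiver gain `g^{(b)} ∈ {gb₁, gb₂}` (probabilities `bb₁`, `bb₂ = 1 − bb₁`), and,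
conditionally on `B`, independent `X_B` (Alzer CDF `(1 − exp(−η_B·x))^{ν_B}`),
`Y_B ∼ Gamma(ν_B, ν_B)` and `P_J` uniform on `[0, Pmax]`, the outage probability
`Pr(Pa·g^{(a)}·g^{(b)}·L_B·X_B < γ_th·(P_J·ms·g^{(b)}·L_B·Y_B + σ_b²))` equals
`∑_B P_B ∑_{k₁} ba_{k₁} ∑_{k₂} bb_{k₂} [1 + ∑_{l=1}^{ν_B} C(ν_B,l)·(−1)^l·
exp(−l·η_B·γ_th·σ_b²/(Pa·ga_{k₁}·gb_{k₂}·L_B))·V(ν_B, l, ga_{k₁})]`. -/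
theorem outage_probability_closed_form
    (Pa Pmax ms γth σb2 : ℝ)
    (hPa : 0 < Pa) (hPmax : 0 < Pmax) (hms : 0 < ms) (hγ : 0 < γth) (hσ : 0 < σb2)
    (νL νN : ℕ) (hνL : 1 ≤ νL) (hνN : 1 ≤ νN)
    (LL LN : ℝ) (hLL : 0 < LL) (hLN : 0 < LN)
    (PL : ℝ) (hPL : PL ∈ Set.Icc (0 : ℝ) 1)
    (ga gb : Fin 2 → ℝ) (hga : ∀ k, 0 < ga k) (hgb : ∀ k, 0 < gb k)
    (ba bb : Fin 2 → ℝ) (hba0 : ba 0 ∈ Set.Icc (0 : ℝ) 1) (hba1 : ba 1 = 1 - ba 0)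
    (hbb0 : bb 0 ∈ Set.Icc (0 : ℝ) 1) (hbb1 : bb 1 = 1 - bb 0)
    (μXL μXN : Measure ℝ) [IsProbabilityMeasure μXL] [IsProbabilityMeasure μXN]
    (hXL : ∀ x : ℝ, (μXL (Iic x)).toReal =
      if 0 ≤ x then (1 - Real.exp (-(etaNak νL) * x)) ^ νL else 0)
    (hXN : ∀ x : ℝ, (μXN (Iic x)).toReal =
      if 0 ≤ x then (1 - Real.exp (-(etaNak νN) * x)) ^ νN else 0) :
    PL * (∑ k1 : Fin 2, ∑ k2 : Fin 2, ba k1 * bb k2 *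
        condOutage Pa Pmax ms γth σb2 LL μXL νL (ga k1) (gb k2)) +
      (1 - PL) * (∑ k1 : Fin 2, ∑ k2 : Fin 2, ba k1 * bb k2 *
        condOutage Pa Pmax ms γth σb2 LN μXN νN (ga k1) (gb k2)) =
    PL * (∑ k1 : Fin 2, ∑ k2 : Fin 2, ba k1 * bb k2 *
        bracketOut Pa Pmax ms γth σb2 LL νL (ga k1) (gb k2)) +
      (1 - PL) * (∑ k1 : Fin 2, ∑ k2 : Fin 2, ba k1 * bb k2 *
        bracketOut Pa Pmax ms γth σb2 LN νN (ga k1) (gb k2)) := by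
  simp only [cond_eq Pa Pmax ms γth σb2 LL hPa hPmax hms hγ hσ hLL νL hνL μXL hXL _ _ (hga _) (hgb _),
    cond_eq Pa Pmax ms γth σb2 LN hPa hPmax hms hγ hσ hLN νN hνN μXN hXN _ _ (hga _) (hgb _)]
end
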